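/- For every nonnegative integer m, lim_{n→∞} Σ_{i=0}^{m} P(f⁺_{[0,⌊n/8⌋−1]}(R_n) = i) · P(f⁺_{[(2n−2)−⌊n/8⌋+1,2n−2]}(R_n) = m−i) = lim_{n→∞} Σ_{i=0}^{m} P(f⁺_{[0,n−1]}(R_n) = i) · P(f⁺_{[n,2n−2]}(R_n) = m−i). -/

import Mathlib

open Finset Filter

open Classical in
/-- The number of missing sums of `R` in the integer interval `[a, b]`, i.e.
`#{k ∈ ℤ ∩ [a,b] : k ∉ R + R}` where `R + R = {x + y : x, y ∈ R}`. -/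
noncomputable def missSum (R : Finset ℕ) (a b : ℤ) : ℕ :=
  ((Finset.Icc a b).filter (fun k => ¬ ∃ x ∈ R, ∃ y ∈ R, (x : ℤ) + (y : ℤ) = k)).card

open Classical in
/-- The number of missing differences of `R` in the integer interval `[a, b]`, i.e.
`#{k ∈ ℤ ∩ [a,b] : k ∉ R - R}` where `R - R = {x - y : x, y ∈ R}`. -/
noncomputable def missDiff (R : Finset ℕ) (a b : ℤ) : ℕ :=
  ((Finset.Icc a b).filter (fun k => ¬ ∃ x ∈ R, ∃ y ∈ R, (x : ℤ) - (y : ℤ) = k)).card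

open Classical in
/-- The probability that the random set `R_n` — a subset of `{0,…,n-1}` in which each
element is included independently with probability `1/2`, i.e. a uniformly random
subset of `{0,…,n-1}` — satisfies the event `p`. -/
noncomputable def pR (n : ℕ) (p : Finset ℕ → Prop) : ℝ :=
  (((Finset.range n).powerset.filter p).card : ℝ) / 2 ^ n

open Classical in
/-- The probability that the random set `R_n'` — a uniformly random subset of
`{0,…,n-1}` conditioned on containing `0` — satisfies the event `p`. -/
noncomputable def pR' (n : ℕ) (p : Finset ℕ → Prop) : ℝ :=
  (((Finset.range n).powerset.filter (fun S => 0 ∈ S ∧ p S)).card : ℝ) / 2 ^ (n - 1)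

open Classical in
/-- The probability that the random set `R_n''` — a uniformly random subset of
`{0,…,n-1}` conditioned on containing both `0` and `n-1` — satisfies the event `p`. -/
noncomputable def pR'' (n : ℕ) (p : Finset ℕ → Prop) : ℝ :=
  (((Finset.range n).powerset.filter (fun S => 0 ∈ S ∧ n - 1 ∈ S ∧ p S)).card : ℝ) / 2 ^ (n - 2)

open Classical in
/-- The probability that the random set `R_∞` — a subset of `ℕ` in which each
nonnegative integer is included independently with probability `1/2` — satisfies the
event `p`, for an event `p` depending only on the elements `< N` of the set.  Since
each of the `2^N` possibilities for `R_∞ ∩ {0,…,N-1}` is equally likely and `p` is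
determined by this intersection, the probability is obtained by counting. -/
noncomputable def probInf (N : ℕ) (p : Finset ℕ → Prop) : ℝ :=
  (((Finset.range N).powerset.filter p).card : ℝ) / 2 ^ N

theorem pR_congr {n : ℕ} {p q : Finset ℕ → Prop}
    (h : ∀ S ⊆ Finset.range n, p S ↔ q S) : pR n p = pR n q := by
  classical
  unfold pR
  congr 3
  apply Finset.filter_congr
  intro S hS
  exact h S (Finset.mem_powerset.1 hS)

theorem pR_mono {n : ℕ} {p q : Finset ℕ → Prop} (h : ∀ S, p S → q S) : pR n p ≤ pR n q := by
  classical
  unfold pR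
  have := Finset.card_le_card
    (Finset.monotone_filter_right (Finset.range n).powerset (fun S _ => h S))
  gcongr

theorem pR_nonneg (n : ℕ) (p : Finset ℕ → Prop) : 0 ≤ pR n p := by
  unfold pR
  positivity

theorem pR_or {n : ℕ} {p q : Finset ℕ → Prop} (h : ∀ S, p S → ¬ q S) :
    pR n (fun S => p S ∨ q S) = pR n p + pR n q := by
  classical
  unfold pR
  rw [← add_div, ← Nat.cast_add, ← Finset.card_union_of_disjoint, ← Finset.filter_or]
  · congr!
  · exact Finset.disjoint_filter.2 fun S _ => h S

/-- An event that does not see the element `n` has the same probability for `R_{n+1}` and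
`R_n`. -/
theorem pR_succ {n : ℕ} {p : Finset ℕ → Prop} (h : ∀ S, p (insert n S) ↔ p S) :
    pR (n + 1) p = pR n p := by
  classical
  unfold pR
  rw [Finset.card_filter, Finset.card_filter, Finset.range_add_one,
    Finset.sum_powerset_insert Finset.notMem_range_self]
  simp only [h]
  push_cast
  rw [pow_succ]
  field_simp
  ring

theorem missSum_insert {n N : ℕ} (hN : N ≤ n) (S : Finset ℕ) :
    missSum (insert n S) 0 ((N : ℤ) - 1) = missSum S 0 ((N : ℤ) - 1) := by
  classical
  unfold missSum
  congr 1
  apply Finset.filter_congr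
  intro k hk
  rw [Finset.mem_Icc] at hk
  apply not_congr
  constructor
  · rintro ⟨x, hx, y, hy, hxy⟩
    refine ⟨x, Finset.mem_of_mem_insert_of_ne hx (by omega), y,
      Finset.mem_of_mem_insert_of_ne hy (by omega), hxy⟩
  · rintro ⟨x, hx, y, hy, hxy⟩
    exact ⟨x, Finset.mem_insert_of_mem hx, y, Finset.mem_insert_of_mem hy, hxy⟩

theorem missSum_mono (S : Finset ℕ) (a : ℤ) {b c : ℤ} (h : b ≤ c) :
    missSum S a b ≤ missSum S a c :=
  Finset.card_le_card (Finset.filter_subset_filter _ (Finset.Icc_subset_Icc_right h))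

/-- The missing sums below `N` depend only on the elements below `N`. -/
theorem pR_missSum_initial (P : ℕ → Prop) {N n : ℕ} (hN : N ≤ n) :
    pR n (fun S => P (missSum S 0 ((N : ℤ) - 1))) =
      pR N (fun S => P (missSum S 0 ((N : ℤ) - 1))) := by
  induction n, hN using Nat.le_induction with
  | base => rfl
  | succ n hn ih =>
    rw [← ih]
    exact pR_succ fun S => by rw [missSum_insert hn]

theorem image_reflect_subset (n : ℕ) {S : Finset ℕ} (hS : S ⊆ Finset.range n) :
    S.image (fun x => n - 1 - x) ⊆ Finset.range n := by
  intro y hy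
  obtain ⟨x, hx, rfl⟩ := Finset.mem_image.1 hy
  have := Finset.mem_range.1 (hS hx)
  exact Finset.mem_range.2 (by omega)

theorem image_reflect_reflect (n : ℕ) {S : Finset ℕ} (hS : S ⊆ Finset.range n) :
    (S.image (fun x => n - 1 - x)).image (fun x => n - 1 - x) = S := by
  rw [Finset.image_image]
  conv_rhs => rw [← Finset.image_id (s := S)]
  apply Finset.image_congr
  intro x hx
  have := Finset.mem_range.1 (hS hx)
  simp only [Function.comp_apply, id]
  omega

theorem pR_reflect (n : ℕ) (p : Finset ℕ → Prop) :
    pR n (fun S => p (S.image (fun x => n - 1 - x))) = pR n p := by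
  classical
  unfold pR
  congr 2
  refine Finset.card_nbij' (fun S => S.image (fun x => n - 1 - x))
    (fun S => S.image (fun x => n - 1 - x)) ?_ ?_ ?_ ?_
  · intro S hS
    simp only [Finset.coe_filter, Finset.mem_powerset, Set.mem_ofPred_eq] at hS ⊢
    exact ⟨image_reflect_subset n hS.1, hS.2⟩
  · intro S hS
    simp only [Finset.coe_filter, Finset.mem_powerset, Set.mem_ofPred_eq] at hS ⊢
    exact ⟨image_reflect_subset n hS.1, by rw [image_reflect_reflect n hS.1]; exact hS.2⟩
  · intro S hS
    simp only [Finset.coe_filter, Finset.mem_powerset, Set.mem_ofPred_eq] at hS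
    exact image_reflect_reflect n hS.1
  · intro S hS
    simp only [Finset.coe_filter, Finset.mem_powerset, Set.mem_ofPred_eq] at hS
    exact image_reflect_reflect n hS.1

theorem missSum_reflect {n : ℕ} {S : Finset ℕ} (hS : S ⊆ Finset.range n) (a b : ℤ) :
    missSum (S.image (fun x => n - 1 - x)) a b =
      missSum S (2 * (n : ℤ) - 2 - b) (2 * (n : ℤ) - 2 - a) := by
  classical
  unfold missSum
  have key : ∀ k : ℤ, (∃ x ∈ S.image (fun x => n - 1 - x), ∃ y ∈ S.image (fun x => n - 1 - x),
      (x : ℤ) + (y : ℤ) = k) ↔ ∃ x ∈ S, ∃ y ∈ S, (x : ℤ) + (y : ℤ) = 2 * (n : ℤ) - 2 - k := by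
    intro k
    simp only [Finset.exists_mem_image]
    refine exists_congr fun x => and_congr_right fun hx => exists_congr fun y =>
      and_congr_right fun hy => ?_
    have := Finset.mem_range.1 (hS hx)
    have := Finset.mem_range.1 (hS hy)
    omega
  refine Finset.card_nbij' (fun k => 2 * (n : ℤ) - 2 - k) (fun k => 2 * (n : ℤ) - 2 - k)
    ?_ ?_ ?_ ?_
  · intro k hk
    simp only [Finset.coe_filter, Finset.mem_Icc, Set.mem_ofPred_eq, key] at hk ⊢
    exact ⟨by omega, hk.2⟩
  · intro k hk
    simp only [Finset.coe_filter, Finset.mem_Icc, Set.mem_ofPred_eq, key, sub_sub_cancel] at hk ⊢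
    exact ⟨by omega, hk.2⟩
  · intro k _
    exact sub_sub_cancel _ _
  · intro k _
    exact sub_sub_cancel _ _

/-- The missing sums among the top `N` possible ones are distributed as those among the
bottom `N`. -/
theorem pR_missSum_final (P : ℕ → Prop) {N n : ℕ} (hN : N ≤ n) :
    pR n (fun S => P (missSum S (2 * (n : ℤ) - 2 - (N : ℤ) + 1) (2 * (n : ℤ) - 2))) =
      pR N (fun S => P (missSum S 0 ((N : ℤ) - 1))) := by
  rw [← pR_missSum_initial P hN, ← pR_reflect n (fun S => P (missSum S 0 ((N : ℤ) - 1)))]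
  refine pR_congr fun S hS => ?_
  rw [missSum_reflect hS, sub_zero, sub_sub_eq_add_sub, sub_add_eq_add_sub]

theorem antitone_pR_missSum_le (i : ℕ) :
    Antitone (fun N : ℕ => pR N (fun S => missSum S 0 ((N : ℤ) - 1) ≤ i)) := by
  refine antitone_nat_of_succ_le fun N => ?_
  rw [← pR_missSum_initial (fun t => t ≤ i) N.le_succ]
  exact pR_mono fun S h => (missSum_mono S 0 (by simp)).trans h

theorem tendsto_pR_missSum_le (i : ℕ) :
    ∃ L : ℝ, Tendsto (fun N : ℕ => pR N (fun S => missSum S 0 ((N : ℤ) - 1) ≤ i))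
      atTop (nhds L) :=
  ⟨_, tendsto_atTop_ciInf (antitone_pR_missSum_le i)
    ⟨0, by rintro _ ⟨N, rfl⟩; exact pR_nonneg _ _⟩⟩

theorem tendsto_pR_missSum_eq (i : ℕ) :
    ∃ L : ℝ, Tendsto (fun N : ℕ => pR N (fun S => missSum S 0 ((N : ℤ) - 1) = i))
      atTop (nhds L) := by
  cases i with
  | zero => simpa only [Nat.le_zero] using tendsto_pR_missSum_le 0
  | succ i =>
    obtain ⟨L, hL⟩ := tendsto_pR_missSum_le (i + 1)
    obtain ⟨M, hM⟩ := tendsto_pR_missSum_le i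
    refine ⟨L - M, (hL.sub hM).congr fun N => ?_⟩
    rw [sub_eq_iff_eq_add', ← pR_or fun S h => by omega]
    exact pR_congr fun S _ => Nat.le_succ_iff

/-- For every nonnegative integer `m`,
`lim_{n→∞} Σ_{i=0}^m P(f⁺_{XS}(R_n) = i) P(f⁺_{XL}(R_n) = m-i)
 = lim_{n→∞} Σ_{i=0}^m P(f⁺_{S}(R_n) = i) P(f⁺_{L}(R_n) = m-i)`,
where `XS = [0,⌊n/8⌋-1]`, `XL = [(2n-2)-⌊n/8⌋+1, 2n-2]`, `S = [0,n-1]`, `L = [n,2n-2]`. -/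
theorem limit_convolution_extreme_eq_halves (m : ℕ) :
    ∃ L : ℝ,
      Tendsto (fun n : ℕ =>
          ∑ i ∈ Finset.range (m + 1),
            pR n (fun S => missSum S 0 (((n / 8 : ℕ) : ℤ) - 1) = i) *
              pR n (fun S =>
                missSum S (2 * (n : ℤ) - 2 - ((n / 8 : ℕ) : ℤ) + 1) (2 * (n : ℤ) - 2) = m - i))
        atTop (nhds L) ∧
      Tendsto (fun n : ℕ =>
          ∑ i ∈ Finset.range (m + 1),
            pR n (fun S => missSum S 0 ((n : ℤ) - 1) = i) *
              pR n (fun S => missSum S (n : ℤ) (2 * (n : ℤ) - 2) = m - i))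
        atTop (nhds L) := by
  choose l hl using tendsto_pR_missSum_eq
  have h8 : Tendsto (fun n : ℕ => n / 8) atTop atTop :=
    Nat.tendsto_div_const_atTop (by norm_num)
  refine ⟨∑ i ∈ Finset.range (m + 1), l i * l (m - i), ?_, ?_⟩
  · refine tendsto_finsetSum _ fun i _ => Tendsto.mul ?_ ?_
    · refine ((hl i).comp h8).congr fun n => ?_
      exact (pR_missSum_initial (· = i) (Nat.div_le_self n 8)).symm
    · refine ((hl (m - i)).comp h8).congr fun n => ?_
      exact (pR_missSum_final (· = m - i) (Nat.div_le_self n 8)).symm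
  · refine tendsto_finsetSum _ fun i _ => (hl i).mul ?_
    refine ((hl (m - i)).comp (tendsto_sub_atTop_nat 1)).congr' ?_
    filter_upwards [eventually_ge_atTop 1] with n hn
    have h : 2 * (n : ℤ) - 2 - ((n - 1 : ℕ) : ℤ) + 1 = n := by omega
    have := pR_missSum_final (· = m - i) (Nat.sub_le n 1)
    rw [h] at this
    exact this.symm
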